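/- Let 0<β≤1 and 0<s<1 with 2s<β. There exists a constant C>0 depending only on s and β such that for every h>0, every j ∈ ℤ, and every bounded differentiable function u : ℝ → ℝ whose derivative u' is bounded with finite Hölder seminorm [u']_{C^{0,β}(ℝ)}, one has |D_+((−Δ_h)^s (r_h u))_j − (−Δ)^s u'(hj)| ≤ C [u']_{C^{0,β}(ℝ)} h^{β−2s}, where D_+ v_j = (v_{j+1} − v_j)/h. -/

import Mathlib

open Real MeasureTheory

/-- The kernel of the one-dimensional fractional discrete Laplacian. -/
noncomputable def Ks (s : ℝ) (m : ℤ) : ℝ :=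
  if m = 0 then 0
  else 4 ^ s * Real.Gamma (1 / 2 + s) * Real.Gamma (|(m : ℝ)| - s) /
    (Real.sqrt Real.pi * |Real.Gamma (-s)| * Real.Gamma (|(m : ℝ)| + 1 + s))

/-- The fractional discrete Laplacian on the mesh `hℤ`. -/
noncomputable def fracDiscLap (s h : ℝ) (u : ℤ → ℝ) (j : ℤ) : ℝ :=
  h ^ (-(2 * s)) * ∑' m : ℤ, (u j - u m) * Ks s (j - m)

/-- The normalizing constant `c_s = 4^s Γ(1/2+s)/(√π |Γ(−s)|)`. -/
noncomputable def cs (s : ℝ) : ℝ :=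
  4 ^ s * Real.Gamma (1 / 2 + s) / (Real.sqrt Real.pi * |Real.Gamma (-s)|)

/-- The fractional Laplacian on `ℝ`, written in second-difference form:
`(−Δ)^s u(x) = (c_s/2) ∫_ℝ (2u(x) − u(x+y) − u(x−y)) / |y|^{1+2s} dy`. -/
noncomputable def fracLap (s : ℝ) (u : ℝ → ℝ) (x : ℝ) : ℝ :=
  (cs s / 2) * ∫ y : ℝ, (2 * u x - u (x + y) - u (x - y)) / |y| ^ (1 + 2 * s)

lemma Real.Gamma_add_le_rpow_mul_Gamma {x a : ℝ} (hx : 0 < x) (ha0 : 0 < a) (ha1 : a < 1) :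
    Real.Gamma (x + a) ≤ x ^ a * Real.Gamma x := by
  have key := Real.Gamma_mul_add_mul_le_rpow_Gamma_mul_rpow_Gamma hx (by linarith : 0 < x + 1)
    (by linarith : 0 < 1 - a) ha0 (by ring)
  have hG := Real.Gamma_pos_of_pos hx
  rw [Real.Gamma_add_one hx.ne', Real.mul_rpow hx.le hG.le] at key
  calc Real.Gamma (x + a) = Real.Gamma ((1 - a) * x + a * (x + 1)) := by congr 1; ring
    _ ≤ _ := key
    _ = x ^ a * (Real.Gamma x ^ (1 - a) * Real.Gamma x ^ a) := by ring
    _ = x ^ a * Real.Gamma x := by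
      rw [← Real.rpow_add hG]; norm_num

lemma one_div_rpow_le_Gamma_ratio {s m : ℝ} (hs0 : 0 < s) (hs1 : s < 1 / 2) (hm : 1 ≤ m) :
    1 / (m + 1) ^ (1 + 2 * s) ≤ Real.Gamma (m - s) / Real.Gamma (m + 1 + s) := by
  have hx : 0 < m - s := by linarith
  have hG := Real.Gamma_pos_of_pos hx
  have hG' := Real.Gamma_pos_of_pos (by linarith : 0 < m + 1 + s)
  have h1 := Real.Gamma_add_le_rpow_mul_Gamma (x := m - s + 1) (a := 2 * s) (by linarith)
    (by linarith) (by linarith)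
  rw [Real.Gamma_add_one hx.ne', show m - s + 1 + 2 * s = m + 1 + s by ring] at h1
  rw [div_le_div_iff₀ (by positivity) hG', one_mul]
  refine h1.trans ?_
  rw [Real.rpow_add (by linarith), Real.rpow_one]
  have h2 : (m - s + 1) ^ (2 * s) ≤ (m + 1) ^ (2 * s) :=
    Real.rpow_le_rpow (by linarith) (by linarith) (by linarith)
  calc _ = Real.Gamma (m - s) * ((m - s) * (m - s + 1) ^ (2 * s)) := by ring
    _ ≤ _ := by gcongr; linarith

lemma Gamma_ratio_le_one_div_rpow {s m : ℝ} (hs0 : 0 < s) (hs1 : s < 1 / 2) (hm : 1 ≤ m) :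
    Real.Gamma (m - s) / Real.Gamma (m + 1 + s) ≤ 1 / (m - 1 / 2) ^ (1 + 2 * s) := by
  have hx : 0 < m - s := by linarith
  have hy : 0 < m + s := by linarith
  have hG := Real.Gamma_pos_of_pos hx
  have hG' := Real.Gamma_pos_of_pos hy
  have h1 := Real.Gamma_add_le_rpow_mul_Gamma (x := m + s) (a := 1 - 2 * s) hy
    (by linarith) (by linarith)
  rw [show m + s + (1 - 2 * s) = m - s + 1 by ring, Real.Gamma_add_one hx.ne'] at h1
  have h3 : (0 : ℝ) < m - 1 / 2 := by linarith
  rw [show m + 1 + s = m + s + 1 by ring, Real.Gamma_add_one hy.ne',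
    div_le_div_iff₀ (by positivity) (by positivity), one_mul]
  have h2 : (m - 1 / 2) ^ (2 * s) ≤ (m + s) ^ (2 * s) :=
    Real.rpow_le_rpow (by linarith) (by linarith) (by linarith)
  have h4 : (m + s) ^ (2 * s) * (m + s) ^ (1 - 2 * s) = m + s := by
    rw [← Real.rpow_add hy]; norm_num
  calc Real.Gamma (m - s) * (m - 1 / 2) ^ (1 + 2 * s)
      = (m - 1 / 2) ^ (2 * s) * ((m - 1 / 2) * Real.Gamma (m - s)) := by
        rw [Real.rpow_add h3, Real.rpow_one]; ring
    _ ≤ (m + s) ^ (2 * s) * ((m - s) * Real.Gamma (m - s)) := by gcongr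
    _ ≤ (m + s) ^ (2 * s) * ((m + s) ^ (1 - 2 * s) * Real.Gamma (m + s)) := by gcongr
    _ = (m + s) * Real.Gamma (m + s) := by rw [← mul_assoc, h4]

lemma one_div_sub_half_rpow_le {p m : ℝ} (hp0 : 0 ≤ p) (hp2 : p ≤ 2) (hm : 1 ≤ m) :
    1 / (m - 1 / 2) ^ p ≤ 4 * (1 / m ^ p) := by
  have h1 : (m / 2) ^ p ≤ (m - 1 / 2) ^ p :=
    Real.rpow_le_rpow (by linarith) (by linarith) hp0
  have h2 : (2 : ℝ) ^ p ≤ 4 := by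
    calc (2 : ℝ) ^ p ≤ 2 ^ (2 : ℝ) := Real.rpow_le_rpow_of_exponent_le (by norm_num) hp2
      _ = 4 := by norm_num
  have h3 : 0 < m ^ p := by positivity
  rw [Real.div_rpow (by linarith) (by norm_num), div_le_iff₀ (by positivity)] at h1
  rw [mul_one_div, div_le_div_iff₀ (Real.rpow_pos_of_pos (by linarith) _) h3, one_mul]
  refine h1.trans ?_
  rw [mul_comm]
  exact mul_le_mul_of_nonneg_right h2 (Real.rpow_nonneg (by linarith) _)

lemma mul_one_div_rpow_sub_le {p m : ℝ} (hp2 : p ≤ 2) (hm : 1 ≤ m) :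
    (m + 1) * (1 / (m - 1 / 2) ^ p - 1 / (m + 1) ^ p) ≤ 3 * (1 / (m - 1 / 2) ^ p) := by
  have hx : 0 < m - 1 / 2 := by linarith
  have hy : 0 < m + 1 := by linarith
  have hq : 0 < (m - 1 / 2) / (m + 1) := by positivity
  have hq1 : (m - 1 / 2) / (m + 1) ≤ 1 := by rw [div_le_one hy]; linarith
  have h1 := Real.rpow_le_rpow_of_exponent_ge hq hq1 hp2
  rw [Real.rpow_two, Real.div_rpow hx.le hy.le] at h1
  have hX := Real.rpow_pos_of_pos hx p
  have hY := Real.rpow_pos_of_pos hy p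
  have h2 : (m + 1) * (1 - ((m - 1 / 2) / (m + 1)) ^ 2) ≤ 3 := by
    have : (m + 1) * (1 - ((m - 1 / 2) / (m + 1)) ^ 2) = 3 * (m + 1 / 4) / (m + 1) := by
      field_simp; ring
    rw [this, div_le_iff₀ hy]; linarith
  have h3 : (m + 1) * (1 - (m - 1 / 2) ^ p / (m + 1) ^ p) ≤ 3 :=
    le_trans (by gcongr) h2
  calc _ = ((m + 1) * (1 - (m - 1 / 2) ^ p / (m + 1) ^ p)) * (1 / (m - 1 / 2) ^ p) := by
        generalize (m - 1 / 2) ^ p = X at *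
        field_simp
    _ ≤ _ := by gcongr

lemma abs_mul_Gamma_ratio_sub_div_rpow_le {s m t L G g : ℝ} (hs0 : 0 < s) (hs1 : s < 1 / 2)
    (hm : 1 ≤ m) (hmt : m ≤ t) (htm : t ≤ m + 1) (hL : 0 ≤ L) (hGg : |G - g| ≤ 5 * L)
    (hg : |g| ≤ 2 * L * (m + 1)) :
    |G * (Real.Gamma (m - s) / Real.Gamma (m + 1 + s)) - g / t ^ (1 + 2 * s)| ≤
      44 * L * (1 / m ^ (1 + 2 * s)) := by
  have hlow := one_div_rpow_le_Gamma_ratio hs0 hs1 hm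
  have hup := Gamma_ratio_le_one_div_rpow hs0 hs1 hm
  have hdiff := mul_one_div_rpow_sub_le (p := 1 + 2 * s) (by linarith) hm
  have hX := one_div_sub_half_rpow_le (p := 1 + 2 * s) (by linarith) (by linarith) hm
  have htlow : 1 / (m + 1) ^ (1 + 2 * s) ≤ 1 / t ^ (1 + 2 * s) :=
    one_div_le_one_div_of_le (Real.rpow_pos_of_pos (by linarith) _)
      (Real.rpow_le_rpow (by linarith) htm (by linarith))
  have htup : 1 / t ^ (1 + 2 * s) ≤ 1 / (m - 1 / 2) ^ (1 + 2 * s) :=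
    one_div_le_one_div_of_le (Real.rpow_pos_of_pos (by linarith) _)
      (Real.rpow_le_rpow (by linarith) (by linarith) (by linarith))
  have hpos : 0 ≤ 1 / (m + 1) ^ (1 + 2 * s) := by positivity
  rw [div_eq_mul_one_div g]
  generalize Real.Gamma (m - s) / Real.Gamma (m + 1 + s) = κ at *
  generalize 1 / (m - 1 / 2) ^ (1 + 2 * s) = X at *
  generalize 1 / (m + 1) ^ (1 + 2 * s) = Y at *
  generalize 1 / t ^ (1 + 2 * s) = T at *
  have hκT : |κ - T| ≤ X - Y := abs_le.2 ⟨by linarith, by linarith⟩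
  calc |G * κ - g * T| = |(G - g) * κ + g * (κ - T)| := by congr 1; ring
    _ ≤ |G - g| * |κ| + |g| * |κ - T| := by
      rw [← abs_mul, ← abs_mul]; exact abs_add_le _ _
    _ ≤ 5 * L * X + 2 * L * (m + 1) * (X - Y) := by
      rw [abs_of_nonneg (hpos.trans hlow)]
      gcongr
      exact hpos.trans hlow
    _ = 5 * L * X + 2 * L * ((m + 1) * (X - Y)) := by ring
    _ ≤ 5 * L * X + 2 * L * (3 * X) := by gcongr
    _ = 11 * L * X := by ring
    _ ≤ 11 * L * (4 * (1 / m ^ (1 + 2 * s))) := by gcongr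
    _ = _ := by ring

lemma continuous_of_abs_sub_le_rpow {V : ℝ → ℝ} {L β : ℝ} (hβ0 : 0 < β)
    (hV : ∀ x y, |V x - V y| ≤ L * |x - y| ^ β) : Continuous V := by
  have hL : 0 ≤ L := by simpa using (abs_nonneg _).trans (hV 0 1)
  lift L to NNReal using hL
  lift β to NNReal using hβ0.le
  have hol : HolderWith L β V := by
    intro x y
    rw [edist_nndist, edist_nndist, ← ENNReal.coe_rpow_of_nonneg _ β.coe_nonneg, ← ENNReal.coe_mul,
      ENNReal.coe_le_coe, ← NNReal.coe_le_coe]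
    push_cast
    rw [Real.dist_eq, Real.dist_eq]
    exact hV x y
  exact hol.continuous (by exact_mod_cast hβ0)

lemma abs_second_difference_le_rpow {V : ℝ → ℝ} {L β : ℝ}
    (hV : ∀ x y, |V x - V y| ≤ L * |x - y| ^ β) {t : ℝ} (ht : 0 ≤ t) :
    |2 * V 0 - V t - V (-t)| ≤ 2 * L * t ^ β := by
  have h1 := hV 0 t
  have h2 := hV 0 (-t)
  rw [zero_sub, abs_neg, abs_of_nonneg ht] at h1
  rw [zero_sub, neg_neg, abs_of_nonneg ht] at h2
  rw [abs_le] at *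
  constructor <;> linarith

lemma integrableOn_Ioi_second_difference {V : ℝ → ℝ} {L M β s : ℝ} (hβ0 : 0 < β)
    (hs0 : 0 < s) (hsβ : 2 * s < β) (hM : ∀ x, |V x| ≤ M)
    (hV : ∀ x y, |V x - V y| ≤ L * |x - y| ^ β) :
    IntegrableOn (fun t => (2 * V 0 - V t - V (-t)) / t ^ (1 + 2 * s)) (Set.Ioi 0) := by
  have hVc := continuous_of_abs_sub_le_rpow hβ0 hV
  have hmeas : ∀ S : Set ℝ, AEStronglyMeasurable
      (fun t => (2 * V 0 - V t - V (-t)) / t ^ (1 + 2 * s)) (volume.restrict S) := by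
    intro S
    apply Measurable.aestronglyMeasurable
    have := hVc.measurable
    fun_prop
  rw [← Set.Ioc_union_Ioi_eq_Ioi zero_le_one, integrableOn_union]
  constructor
  · have h1 : IntegrableOn (fun t : ℝ => 2 * L * t ^ (β - (1 + 2 * s))) (Set.Ioc 0 1) :=
      ((intervalIntegrable_iff_integrableOn_Ioc_of_le zero_le_one).1
        (intervalIntegral.intervalIntegrable_rpow' (by linarith))).const_mul _
    refine Integrable.mono' h1 (hmeas _) ?_
    filter_upwards [ae_restrict_mem measurableSet_Ioc] with t ht
    have hp : 0 < t ^ (1 + 2 * s) := Real.rpow_pos_of_pos ht.1 _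
    rw [Real.norm_eq_abs, abs_div, abs_of_pos hp, Real.rpow_sub ht.1, ← mul_div_assoc]
    gcongr
    exact abs_second_difference_le_rpow hV ht.1.le
  · have h1 : IntegrableOn (fun t : ℝ => 4 * M * t ^ (-(1 + 2 * s))) (Set.Ioi 1) :=
      (integrableOn_Ioi_rpow_of_lt (by linarith) one_pos).const_mul _
    refine Integrable.mono' h1 (hmeas _) ?_
    filter_upwards [ae_restrict_mem measurableSet_Ioi] with t ht
    have ht0 : 0 < t := one_pos.trans ht
    have hp : 0 < t ^ (1 + 2 * s) := Real.rpow_pos_of_pos ht0 _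
    rw [Real.norm_eq_abs, abs_div, abs_of_pos hp, Real.rpow_neg ht0.le, ← div_eq_mul_inv]
    gcongr
    have a1 := abs_le.1 (hM 0)
    have a2 := abs_le.1 (hM t)
    have a3 := abs_le.1 (hM (-t))
    rw [abs_le]
    constructor <;> linarith

lemma abs_integral_Ioc_second_difference_le {V : ℝ → ℝ} {L β s : ℝ} (hsβ : 2 * s < β)
    (hV : ∀ x y, |V x - V y| ≤ L * |x - y| ^ β) :
    |∫ t in (0 : ℝ)..1, (2 * V 0 - V t - V (-t)) / t ^ (1 + 2 * s)| ≤
      2 / (β - 2 * s) * L := by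
  have hexp : -1 < β - (1 + 2 * s) := by linarith
  have key := intervalIntegral.norm_integral_le_of_norm_le (μ := volume) zero_le_one
    (f := fun t => (2 * V 0 - V t - V (-t)) / t ^ (1 + 2 * s))
    (g := fun t : ℝ => 2 * L * t ^ (β - (1 + 2 * s)))
    (Filter.Eventually.of_forall fun t ht => by
      have hp : 0 < t ^ (1 + 2 * s) := Real.rpow_pos_of_pos ht.1 _
      rw [Real.norm_eq_abs, abs_div, abs_of_pos hp, Real.rpow_sub ht.1, ← mul_div_assoc]
      gcongr
      exact abs_second_difference_le_rpow hV ht.1.le)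
    ((intervalIntegral.intervalIntegrable_rpow' hexp).const_mul _)
  rw [Real.norm_eq_abs] at key
  refine key.trans (le_of_eq ?_)
  rw [intervalIntegral.integral_const_mul, integral_rpow (Or.inl hexp), Real.one_rpow,
    Real.zero_rpow (by linarith)]
  have h1 : β - (1 + 2 * s) + 1 ≠ 0 := by linarith
  have h2 : β - 2 * s ≠ 0 := by linarith
  rw [show β - (1 + 2 * s) + 1 = β - 2 * s by ring]
  field_simp
  ring

lemma abs_term_sub_intervalIntegral_le {V : ℝ → ℝ} {w : ℤ → ℝ} {L β s : ℝ} (hβ0 : 0 < β)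
    (hβ1 : β ≤ 1) (hs0 : 0 < s) (hs1 : s < 1 / 2)
    (hV : ∀ x y, |V x - V y| ≤ L * |x - y| ^ β)
    (hw : ∀ m : ℤ, ∃ ξ ∈ Set.Icc (m : ℝ) (m + 1), w m = V ξ) (n : ℕ) :
    |(2 * w 0 - w (n + 1) - w (-(n + 1))) *
        (Real.Gamma ((n + 1 : ℝ) - s) / Real.Gamma ((n + 1 : ℝ) + 1 + s)) -
      ∫ t in (n + 1 : ℝ)..(n + 1 + 1), (2 * V 0 - V t - V (-t)) / t ^ (1 + 2 * s)| ≤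
      44 * L * (1 / (n + 1 : ℝ) ^ (1 + 2 * s)) := by
  have hL : 0 ≤ L := by simpa using (abs_nonneg _).trans (hV 0 1)
  have hVc := continuous_of_abs_sub_le_rpow hβ0 hV
  have hclose : ∀ x y d : ℝ, 1 ≤ d → |x - y| ≤ d → |V x - V y| ≤ L * d := by
    intro x y d hd hxy
    refine (hV x y).trans (mul_le_mul_of_nonneg_left ?_ hL)
    calc |x - y| ^ β ≤ d ^ β := Real.rpow_le_rpow (abs_nonneg _) hxy hβ0.le
      _ ≤ d ^ (1 : ℝ) := Real.rpow_le_rpow_of_exponent_le hd hβ1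
      _ = d := Real.rpow_one d
  obtain ⟨a, ha, hwa⟩ := hw 0
  obtain ⟨b, hb, hwb⟩ := hw (n + 1)
  obtain ⟨c, hc, hwc⟩ := hw (-(n + 1))
  push_cast at ha hb hc
  have hm : (1 : ℝ) ≤ n + 1 := by linarith [n.cast_nonneg (α := ℝ)]
  set m : ℝ := n + 1
  set G := 2 * w 0 - w (n + 1) - w (-(n + 1)) with hG
  set κ := Real.Gamma (m - s) / Real.Gamma (m + 1 + s) with hκ
  have hpt : ∀ t ∈ Set.uIoc m (m + 1),
      ‖G * κ - (2 * V 0 - V t - V (-t)) / t ^ (1 + 2 * s)‖ ≤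
        44 * L * (1 / m ^ (1 + 2 * s)) := by
    intro t ht
    rw [Set.uIoc_of_le (by linarith)] at ht
    obtain ⟨ht1, ht2⟩ := ht
    rw [Real.norm_eq_abs]
    refine abs_mul_Gamma_ratio_sub_div_rpow_le hs0 hs1 hm ht1.le ht2 hL ?_ ?_
    · have e1 := abs_le.1 (hclose a 0 1 le_rfl (abs_le.2 ⟨by linarith [ha.1], by linarith [ha.2]⟩))
      have e2 := abs_le.1 (hclose b t 1 le_rfl (abs_le.2 ⟨by linarith [hb.1], by linarith [hb.2]⟩))
      have e3 := abs_le.1 (hclose c (-t) 2 one_le_two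
        (abs_le.2 ⟨by linarith [hc.1], by linarith [hc.2]⟩))
      rw [hG, hwa, hwb, hwc, abs_le]
      constructor <;> linarith
    · refine (abs_second_difference_le_rpow hV (by linarith)).trans ?_
      gcongr
      calc t ^ β ≤ t ^ (1 : ℝ) := Real.rpow_le_rpow_of_exponent_le (by linarith) hβ1
        _ = t := Real.rpow_one t
        _ ≤ m + 1 := ht2
  have hφint : IntervalIntegrable (fun t => (2 * V 0 - V t - V (-t)) / t ^ (1 + 2 * s))
      volume m (m + 1) := by
    apply ContinuousOn.intervalIntegrable
    rw [Set.uIcc_of_le (by linarith)]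
    have hpos : ∀ t ∈ Set.Icc m (m + 1), 0 < t := fun t ht => by linarith [ht.1]
    refine ContinuousOn.div (by fun_prop) ?_ fun t ht => (Real.rpow_pos_of_pos (hpos t ht) _).ne'
    exact continuousOn_id.rpow_const fun t ht => Or.inl (hpos t ht).ne'
  have key := intervalIntegral.norm_integral_le_of_norm_le_const hpt
  rw [intervalIntegral.integral_sub (by simp) hφint, intervalIntegral.integral_const,
    Real.norm_eq_abs] at key
  simpa using key

lemma cs_nonneg {s : ℝ} (hs0 : 0 < s) : 0 ≤ cs s := by
  have := Real.Gamma_pos_of_pos (by linarith : 0 < 1 / 2 + s)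
  unfold cs
  positivity

lemma Ks_neg (s : ℝ) (m : ℤ) : Ks s (-m) = Ks s m := by
  simp [Ks]

lemma Ks_natCast_add_one (s : ℝ) (n : ℕ) :
    Ks s (n + 1) =
      cs s * (Real.Gamma ((n + 1 : ℝ) - s) / Real.Gamma ((n + 1 : ℝ) + 1 + s)) := by
  have h0 : (n + 1 : ℤ) ≠ 0 := by positivity
  have h1 : |((n + 1 : ℤ) : ℝ)| = n + 1 := by
    push_cast
    exact abs_of_nonneg (by positivity)
  rw [Ks, if_neg h0, h1, cs, div_mul_div_comm]

lemma summable_one_div_natCast_add_one_rpow {p : ℝ} (hp : 1 < p) :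
    Summable fun n : ℕ => 1 / (n + 1 : ℝ) ^ p := by
  have := (summable_nat_add_iff 1).2 (Real.summable_one_div_nat_rpow.2 hp)
  simpa using this

lemma summable_Ks {s : ℝ} (hs0 : 0 < s) (hs1 : s < 1 / 2) : Summable (Ks s) := by
  have hpos : Summable fun n : ℕ => Ks s (n + 1) := by
    simp_rw [Ks_natCast_add_one]
    refine Summable.mul_left _ (Summable.of_nonneg_of_le (fun n => ?_) (fun n => ?_)
      ((summable_one_div_natCast_add_one_rpow (by linarith : 1 < 1 + 2 * s)).mul_left 4))
    · exact (by positivity : (0 : ℝ) ≤ 1 / (n + 1 + 1) ^ (1 + 2 * s)).trans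
        (one_div_rpow_le_Gamma_ratio hs0 hs1 (by simp))
    · exact (Gamma_ratio_le_one_div_rpow hs0 hs1 (by simp)).trans
        (one_div_sub_half_rpow_le (by linarith) (by linarith) (by simp))
  refine Summable.of_add_one_of_neg_add_one hpos ?_
  simpa only [Ks_neg] using hpos

lemma summable_mul_Ks {s M : ℝ} (hs0 : 0 < s) (hs1 : s < 1 / 2) {a : ℤ → ℝ}
    (ha : ∀ m, |a m| ≤ M) : Summable fun m => a m * Ks s m := by
  refine Summable.of_norm_bounded ((summable_Ks hs0 hs1).abs.mul_left M) fun m => ?_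
  rw [Real.norm_eq_abs, abs_mul]
  gcongr
  exact ha m

lemma hasSum_symmetrized_Ks {s M : ℝ} (hs0 : 0 < s) (hs1 : s < 1 / 2) {w : ℤ → ℝ}
    (hw : ∀ m, |w m| ≤ M) :
    HasSum (fun n : ℕ => cs s * ((2 * w 0 - w (n + 1) - w (-(n + 1))) *
        (Real.Gamma ((n + 1 : ℝ) - s) / Real.Gamma ((n + 1 : ℝ) + 1 + s))))
      (∑' m : ℤ, (w 0 - w (-m)) * Ks s m) := by
  set f : ℤ → ℝ := fun m => (w 0 - w (-m)) * Ks s m with hf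
  have hsum : Summable f :=
    summable_mul_Ks (M := M + M) hs0 hs1 fun m =>
      (abs_sub _ _).trans (add_le_add (hw _) (hw _))
  have h1 : Summable fun n : ℕ => f (n + 1) :=
    hsum.comp_injective (i := fun n : ℕ => (n + 1 : ℤ)) fun a b hab => by simpa using hab
  have h2 : Summable fun n : ℕ => f (-(n + 1)) :=
    hsum.comp_injective (i := fun n : ℕ => (-(n + 1) : ℤ)) fun a b hab => by simpa using hab
  have hf0 : f 0 = 0 := by simp [hf]
  have htsum := tsum_of_add_one_of_neg_add_one h1 h2
  rw [hf0, add_zero, ← h1.tsum_add h2] at htsum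
  have hterm : (fun n : ℕ => cs s * ((2 * w 0 - w (n + 1) - w (-(n + 1))) *
        (Real.Gamma ((n + 1 : ℝ) - s) / Real.Gamma ((n + 1 : ℝ) + 1 + s)))) =
      fun n : ℕ => f (n + 1) + f (-(n + 1)) := by
    ext n
    simp only [hf]
    rw [Ks_neg, neg_neg, Ks_natCast_add_one]
    ring
  rw [hterm, htsum]
  exact (h1.add h2).hasSum

lemma abs_tsum_Ks_sub_integral_le {V : ℝ → ℝ} {w : ℤ → ℝ} {L M β s : ℝ} (hβ0 : 0 < β)
    (hβ1 : β ≤ 1) (hs0 : 0 < s) (hsβ : 2 * s < β) (hM : ∀ x, |V x| ≤ M)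
    (hV : ∀ x y, |V x - V y| ≤ L * |x - y| ^ β)
    (hw : ∀ m : ℤ, ∃ ξ ∈ Set.Icc (m : ℝ) (m + 1), w m = V ξ) :
    |∑' m : ℤ, (w 0 - w (-m)) * Ks s m -
      cs s * ∫ t in Set.Ioi (0 : ℝ), (2 * V 0 - V t - V (-t)) / t ^ (1 + 2 * s)| ≤
      cs s * (44 * ∑' n : ℕ, 1 / (n + 1 : ℝ) ^ (1 + 2 * s) + 2 / (β - 2 * s)) * L := by
  have hs1 : s < 1 / 2 := by linarith
  have hL : 0 ≤ L := by simpa using (abs_nonneg _).trans (hV 0 1)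
  have hwM : ∀ m, |w m| ≤ M := fun m => by
    obtain ⟨ξ, -, h⟩ := hw m
    rw [h]
    exact hM ξ
  set φ : ℝ → ℝ := fun t => (2 * V 0 - V t - V (-t)) / t ^ (1 + 2 * s) with hφ
  have hφi : IntegrableOn φ (Set.Ioi 0) :=
    integrableOn_Ioi_second_difference hβ0 hs0 hsβ hM hV
  have hii : ∀ a b : ℝ, 0 ≤ a → 0 ≤ b → IntervalIntegrable φ volume a b := fun a b ha hb =>
    intervalIntegrable_iff.2 (hφi.mono_set fun x hx => (le_min ha hb).trans_lt hx.1)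
  have hlim1 := (hasSum_symmetrized_Ks hs0 hs1 hwM).tendsto_sum_nat
  have hlim2 := intervalIntegral_tendsto_integral_Ioi 0 hφi
    (Filter.tendsto_atTop_add_const_right _ (1 : ℝ) tendsto_natCast_atTop_atTop)
  have hsum := summable_one_div_natCast_add_one_rpow (by linarith : 1 < 1 + 2 * s)
  refine le_of_tendsto (hlim1.sub (hlim2.const_mul (cs s))).abs
    (Filter.Eventually.of_forall fun N => ?_)
  have hsplit : ∫ t in (0 : ℝ)..(N + 1), φ t = (∫ t in (0 : ℝ)..1, φ t) +
      ∑ n ∈ Finset.range N, ∫ t in (n + 1 : ℝ)..(n + 1 + 1), φ t := by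
    have hadj := intervalIntegral.sum_integral_adjacent_intervals (f := φ) (μ := volume)
      (a := fun n : ℕ => (n + 1 : ℝ)) (n := N) fun k _ => hii _ _ (by positivity) (by positivity)
    push_cast at hadj
    rw [hadj, zero_add, intervalIntegral.integral_add_adjacent_intervals
      (hii _ _ le_rfl zero_le_one) (hii _ _ zero_le_one (by positivity))]
  rw [hsplit, ← Finset.mul_sum, ← mul_sub, abs_mul, abs_of_nonneg (cs_nonneg hs0), mul_assoc]
  refine mul_le_mul_of_nonneg_left ?_ (cs_nonneg hs0)
  rw [add_comm (∫ t in (0 : ℝ)..1, φ t), ← sub_sub, ← Finset.sum_sub_distrib, add_mul]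
  refine (abs_sub _ _).trans (add_le_add ?_ (abs_integral_Ioc_second_difference_le hsβ hV))
  calc _ ≤ ∑ n ∈ Finset.range N, 44 * L * (1 / (n + 1 : ℝ) ^ (1 + 2 * s)) :=
        (Finset.abs_sum_le_sum_abs _ _).trans (Finset.sum_le_sum fun n _ =>
          abs_term_sub_intervalIntegral_le hβ0 hβ1 hs0 hs1 hV hw n)
    _ = 44 * L * ∑ n ∈ Finset.range N, 1 / (n + 1 : ℝ) ^ (1 + 2 * s) := by
        rw [Finset.mul_sum]
    _ ≤ 44 * L * ∑' n : ℕ, 1 / (n + 1 : ℝ) ^ (1 + 2 * s) := by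
        gcongr
        exact hsum.sum_le_tsum _ fun _ _ => by positivity
    _ = _ := by ring

lemma fracLap_eq_integral_Ioi (s : ℝ) {h : ℝ} (hh : 0 < h) (v : ℝ → ℝ) (x : ℝ) :
    fracLap s v x = h ^ (-(2 * s)) * (cs s *
      ∫ t in Set.Ioi (0 : ℝ), (2 * v x - v (x + h * t) - v (x - h * t)) / t ^ (1 + 2 * s)) := by
  set F : ℝ → ℝ := fun z => (2 * v x - v (x + z) - v (x - z)) / z ^ (1 + 2 * s) with hF
  have heven : ∫ y : ℝ, (2 * v x - v (x + y) - v (x - y)) / |y| ^ (1 + 2 * s) =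
      ∫ y : ℝ, F |y| := by
    congr 1
    ext y
    rcases abs_choice y with hy | hy <;> simp only [hF, hy]
    rw [sub_neg_eq_add, ← sub_eq_add_neg, sub_right_comm]
  have hscale := integral_comp_mul_left_Ioi F 0 hh
  rw [mul_zero, smul_eq_mul, eq_inv_mul_iff_mul_eq₀ hh.ne'] at hscale
  have hpow : h * (h ^ (1 + 2 * s))⁻¹ = h ^ (-(2 * s)) := by
    rw [← Real.rpow_neg hh.le]
    nth_rewrite 1 [← Real.rpow_one h]
    rw [← Real.rpow_add hh]
    congr 1
    ring
  have hcongr : ∫ t in Set.Ioi (0 : ℝ), F (h * t) =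
      (h ^ (1 + 2 * s))⁻¹ * ∫ t in Set.Ioi (0 : ℝ),
        (2 * v x - v (x + h * t) - v (x - h * t)) / t ^ (1 + 2 * s) := by
    rw [← integral_const_mul]
    refine setIntegral_congr_fun measurableSet_Ioi fun t ht => ?_
    have ht0 : (0 : ℝ) < t := ht
    simp only [hF]
    rw [Real.mul_rpow hh.le ht0.le]
    field_simp
  rw [fracLap, heven, integral_comp_abs, ← hscale, hcongr, ← hpow]
  ring

lemma fracDiscLap_forward_difference {s h M : ℝ} (hs0 : 0 < s) (hs1 : s < 1 / 2)
    {a : ℤ → ℝ} (ha : ∀ m, |a m| ≤ M) (j : ℤ) :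
    (fracDiscLap s h a (j + 1) - fracDiscLap s h a j) / h =
      h ^ (-(2 * s)) * ∑' m : ℤ, ((a (j + 1) - a j) / h -
        (a (j + -m + 1) - a (j + -m)) / h) * Ks s m := by
  have hre : ∀ i : ℤ, ∑' m : ℤ, (a i - a m) * Ks s (i - m) =
      ∑' m : ℤ, (a i - a (i - m)) * Ks s m := by
    intro i
    rw [← (Equiv.subLeft i).tsum_eq]
    simp
  have hsum : ∀ i : ℤ, Summable fun m : ℤ => (a i - a (i - m)) * Ks s m := fun i =>
    summable_mul_Ks (M := M + M) hs0 hs1 fun m => (abs_sub _ _).trans (add_le_add (ha _) (ha _))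
  rw [fracDiscLap, fracDiscLap, hre, hre, ← mul_sub, ← (hsum (j + 1)).tsum_sub (hsum j),
    mul_div_assoc, ← tsum_div_const]
  congr 2
  ext m
  rw [show j + -m + 1 = j + 1 - m by ring, show j + -m = j - m by ring]
  ring

theorem consistency_Holder_derivative (β s : ℝ) (hβ0 : 0 < β) (hβ1 : β ≤ 1)
    (hs0 : 0 < s) (hs1 : s < 1) (hsβ : 2 * s < β) :
    ∃ C : ℝ, 0 < C ∧ ∀ (h : ℝ), 0 < h → ∀ (j : ℤ) (u : ℝ → ℝ) (L : ℝ),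
      (∃ M : ℝ, ∀ x : ℝ, |u x| ≤ M) →
      Differentiable ℝ u →
      (∃ M : ℝ, ∀ x : ℝ, |deriv u x| ≤ M) →
      (∀ x y : ℝ, |deriv u x - deriv u y| ≤ L * |x - y| ^ β) →
      |(fracDiscLap s h (fun m : ℤ => u (h * m)) (j + 1) -
          fracDiscLap s h (fun m : ℤ => u (h * m)) j) / h -
        fracLap s (deriv u) (h * j)| ≤ C * L * h ^ (β - 2 * s) := by
  have hS : 0 ≤ ∑' n : ℕ, 1 / (n + 1 : ℝ) ^ (1 + 2 * s) := tsum_nonneg fun n => by positivity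
  have hcs := cs_nonneg hs0
  have hβs : 0 < β - 2 * s := by linarith
  refine ⟨cs s * (44 * ∑' n : ℕ, 1 / (n + 1 : ℝ) ^ (1 + 2 * s) + 2 / (β - 2 * s)) + 1,
    by positivity, ?_⟩
  rintro h hh j u L ⟨M, hM⟩ hu ⟨M', hM'⟩ hL
  have hL0 : 0 ≤ L := by simpa using (abs_nonneg _).trans (hL 0 1)
  set V : ℝ → ℝ := fun t => deriv u (h * j + h * t) with hVdef
  set w : ℤ → ℝ := fun m => (u (h * ((j + m + 1 : ℤ) : ℝ)) - u (h * ((j + m : ℤ) : ℝ))) / h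
    with hwdef
  have hV : ∀ x y, |V x - V y| ≤ L * h ^ β * |x - y| ^ β := by
    intro x y
    refine (hL _ _).trans (le_of_eq ?_)
    rw [show h * (j : ℝ) + h * x - (h * j + h * y) = h * (x - y) by ring, abs_mul,
      abs_of_pos hh, Real.mul_rpow hh.le (abs_nonneg _), mul_assoc]
  have hw : ∀ m : ℤ, ∃ ξ ∈ Set.Icc (m : ℝ) (m + 1), w m = V ξ := by
    intro m
    obtain ⟨c, hc, hcd⟩ := exists_deriv_eq_slope u
      (a := h * ((j + m : ℤ) : ℝ)) (b := h * ((j + m + 1 : ℤ) : ℝ))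
      (mul_lt_mul_of_pos_left (by push_cast; linarith) hh) hu.continuous.continuousOn hu.differentiableOn
    push_cast at hc
    refine ⟨c / h - j, ⟨?_, ?_⟩, ?_⟩
    · rw [le_sub_iff_add_le, le_div_iff₀ hh]
      linarith [hc.1]
    · rw [sub_le_iff_le_add, div_le_iff₀ hh]
      linarith [hc.2]
    · simp only [hVdef, hwdef]
      rw [show h * (j : ℝ) + h * (c / h - j) = c by field_simp; ring, hcd]
      congr 1
      push_cast
      ring
  have key := abs_tsum_Ks_sub_integral_le hβ0 hβ1 hs0 hsβ (fun x => hM' _) hV hw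
  have hdisc := fracDiscLap_forward_difference (a := fun m : ℤ => u (h * m)) hs0
    (by linarith) (fun m => hM _) j (h := h)
  have hdisc' : (fracDiscLap s h (fun m : ℤ => u (h * m)) (j + 1) -
      fracDiscLap s h (fun m : ℤ => u (h * m)) j) / h =
      h ^ (-(2 * s)) * ∑' m : ℤ, (w 0 - w (-m)) * Ks s m := by
    rw [hdisc]
    simp only [hwdef, add_zero]
  have hcont : fracLap s (deriv u) (h * j) = h ^ (-(2 * s)) * (cs s *
      ∫ t in Set.Ioi (0 : ℝ), (2 * V 0 - V t - V (-t)) / t ^ (1 + 2 * s)) := by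
    rw [fracLap_eq_integral_Ioi s hh]
    simp only [hVdef, mul_zero, add_zero, mul_neg, ← sub_eq_add_neg]
  have hpow : h ^ (β - 2 * s) = h ^ (-(2 * s)) * h ^ β := by
    rw [← Real.rpow_add hh]
    congr 1
    ring
  have hnn : 0 ≤ h ^ (-(2 * s)) := by positivity
  rw [hdisc', hcont, ← mul_sub, abs_mul, abs_of_nonneg hnn, hpow]
  refine (mul_le_mul_of_nonneg_left key hnn).trans ?_
  have hextra : 0 ≤ L * (h ^ (-(2 * s)) * h ^ β) := by positivity
  linarith
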